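/- Let G be a connected P4-free simple graph and let S be a cutset of G such that each vertex in S is adjacent to vertices of at least two distinct connected components of G − S. Let R be a connected component of G − S, and let G′ be the graph obtained from G by contracting R into a single vertex (identifying all vertices of R to one vertex, with the new vertex adjacent to exactly the vertices of G − V(R) having a neighbor in R). Then G′ is P4-free. -/

import Mathlib

open SimpleGraph

variable {V : Type*} {W : Type*}

/-- A graph is `P₄`-free if it contains no induced subgraph isomorphic to the
path on four vertices. -/
def P4Free (G : SimpleGraph V) : Prop := IsEmpty (SimpleGraph.pathGraph 4 ↪g G)

/-- `R` is (the vertex set of) a connected component of `G - S`: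
a maximal subset of `V(G) - S` inducing a connected subgraph. -/
def IsCompOf (G : SimpleGraph V) (S R : Set V) : Prop :=
  R ⊆ Sᶜ ∧ (G.induce R).Connected ∧
    ∀ R' : Set V, R ⊆ R' → R' ⊆ Sᶜ → (G.induce R').Connected → R' = R

/-- The number of connected components of `G - S`. -/
noncomputable def numComp (G : SimpleGraph V) (S : Set V) : ℕ :=
  {R : Set V | IsCompOf G S R}.ncard

/-- `S` is a cutset of `G` : the graph `G - S` is disconnected. -/
def IsCutset (G : SimpleGraph V) (S : Set V) : Prop := 2 ≤ numComp G S

/-- `G` is `t`-tough: for every cutset `S`, `t * c(G - S) ≤ |S|`. -/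
def Tough (t : ℝ) (G : SimpleGraph V) : Prop :=
  ∀ S : Set V, IsCutset G S → t * (numComp G S : ℝ) ≤ (S.ncard : ℝ)

/-- `t` is the toughness of `G` : the largest `s` such that `G` is `s`-tough.
(For a complete graph no such largest `s` exists; the toughness is infinite.) -/
def IsToughness (G : SimpleGraph V) (t : ℝ) : Prop :=
  Tough t G ∧ ∀ s : ℝ, Tough s G → s ≤ t

/-- `S` is a tough-set of `G` (whose toughness is `t`): a cutset with
`|S| = t * c(G - S)`. -/
def ToughSet (G : SimpleGraph V) (t : ℝ) (S : Set V) : Prop :=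
  IsCutset G S ∧ (S.ncard : ℝ) = t * (numComp G S : ℝ)

/-- Vertex `u` is adjacent in `G` to some vertex of the set `R`. -/
def AdjToSet (G : SimpleGraph V) (u : V) (R : Set V) : Prop := ∃ v ∈ R, G.Adj u v

/-- `G` has a Hamiltonian cycle. -/
def HasHamCycle [DecidableEq V] (G : SimpleGraph V) : Prop :=
  ∃ (v : V) (w : G.Walk v v), w.IsHamiltonianCycle

/-- `G` has a spanning `k`-walk: a closed walk visiting every vertex at least once
and at most `k` times.  (In a nontrivial closed walk the base vertex occurs one
extra time in `Walk.support`, whence the correction term.) -/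
def HasSpanningKWalk [DecidableEq V] (G : SimpleGraph V) (k : ℕ) : Prop :=
  ∃ (v : V) (w : G.Walk v v), (∀ x : V, x ∈ w.support) ∧
    ∀ x : V, w.support.count x ≤ k + (if x = v then 1 else 0)

/-- The prism over `G`: the Cartesian (box) product `G □ K₂`. -/
def prism (G : SimpleGraph V) : SimpleGraph (V × Fin 2) :=
  G.boxProd (⊤ : SimpleGraph (Fin 2))

/-- The graph obtained from `G` by contracting the set `R` to a single vertex
(namely `Sum.inr ()`), which is adjacent to exactly those vertices outside `R`
having a neighbor in `R`. -/
def contractSet (G : SimpleGraph V) (R : Set V) : SimpleGraph (↥(Rᶜ) ⊕ Unit) :=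
  SimpleGraph.fromRel fun x y =>
    match x, y with
    | Sum.inl a, Sum.inl b => G.Adj ↑a ↑b
    | Sum.inl a, Sum.inr _ => ∃ r ∈ R, G.Adj ↑a r
    | _, _ => False

/-- `v` is a cutvertex of `H` : deleting `v` leaves a disconnected
(non-preconnected) graph. -/
def IsCutvertex (H : SimpleGraph W) (v : W) : Prop :=
  ¬ (H.induce ({v}ᶜ : Set W)).Preconnected

/-- `B` is a block of `H` : a maximal connected subgraph having no cutvertex of
its own. -/
def IsBlock (H : SimpleGraph W) (B : H.Subgraph) : Prop :=
  B.coe.Connected ∧ (∀ v, ¬ IsCutvertex B.coe v) ∧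
    ∀ B' : H.Subgraph, B ≤ B' → B'.coe.Connected →
      (∀ v, ¬ IsCutvertex B'.coe v) → B' = B

/-- `H` is a cycle of even length. -/
def IsEvenCycleGraph (H : SimpleGraph W) : Prop :=
  ∃ n : ℕ, Even n ∧ 3 ≤ n ∧ Nonempty (H ≃g SimpleGraph.cycleGraph n)

/-- `H` is a single edge. -/
def IsSingleEdgeGraph (H : SimpleGraph W) : Prop :=
  ∃ u v : W, u ≠ v ∧ H.Adj u v ∧ ∀ w : W, w = u ∨ w = v

/-- `H` is a simple block EP (SBEP) graph: a connected graph in which every block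
is an even cycle or a single edge, and every vertex lies in at most two blocks. -/
def IsSBEP (H : SimpleGraph W) : Prop :=
  H.Connected ∧
    (∀ B : H.Subgraph, IsBlock H B → IsEvenCycleGraph B.coe ∨ IsSingleEdgeGraph B.coe) ∧
    ∀ (v : W) (B₁ B₂ B₃ : H.Subgraph),
      IsBlock H B₁ ∧ v ∈ B₁.verts → IsBlock H B₂ ∧ v ∈ B₂.verts →
      IsBlock H B₃ ∧ v ∈ B₃.verts → B₁ = B₂ ∨ B₁ = B₃ ∨ B₂ = B₃

/-- `v` is a single-block vertex of `H` : it lies in exactly one block. -/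
def SingleBlockVertex (H : SimpleGraph W) (v : W) : Prop :=
  ∃! B : H.Subgraph, IsBlock H B ∧ v ∈ B.verts

theorem P4Free.false_of_induced_path {G : SimpleGraph V} (hG : P4Free G) {a b c d : V}
    (hab : G.Adj a b) (hbc : G.Adj b c) (hcd : G.Adj c d)
    (hac : ¬ G.Adj a c) (hbd : ¬ G.Adj b d) (had : ¬ G.Adj a d) : False := by
  have key : ∀ i j : Fin 4, G.Adj (![a, b, c, d] i) (![a, b, c, d] j) ↔
      (SimpleGraph.pathGraph 4).Adj i j := by
    intro i j
    rw [SimpleGraph.pathGraph_adj]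
    fin_cases i <;> fin_cases j <;> simp [hab, hbc, hcd, hac, hbd, had, hab.symm, hbc.symm,
      hcd.symm, G.adj_comm c a, G.adj_comm d b, G.adj_comm d a]
  have hinj : Function.Injective ![a, b, c, d] := by
    intro i j hij
    have hac' : a ≠ c := by rintro rfl; exact had hcd
    have hbd' : b ≠ d := by rintro rfl; exact had hab
    have had' : a ≠ d := by rintro rfl; exact hac hcd.symm
    fin_cases i <;> fin_cases j <;>
      simp_all [hab.ne, hbc.ne, hcd.ne, hab.ne', hbc.ne', hcd.ne', hac'.symm, hbd'.symm, had'.symm]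
  exact hG.false ⟨⟨![a, b, c, d], hinj⟩, key _ _⟩

theorem P4Free.of_embedding {G : SimpleGraph V} {H : SimpleGraph W} (hG : P4Free G)
    (f : H ↪g G) : P4Free H :=
  ⟨fun g => hG.false (f.comp g)⟩

theorem IsCompOf.mem_of_adj {G : SimpleGraph V} {S R : Set V} (hR : IsCompOf G S R) {u r : V}
    (hr : r ∈ R) (hur : G.Adj u r) (hu : u ∉ R) : u ∈ S := by
  by_contra huS
  have hconn : (G.induce (R ∪ {r, u})).Connected :=
    SimpleGraph.induce_union_connected hR.2.1.preconnected
      (SimpleGraph.induce_pair_connected_of_adj hur.symm).preconnected ⟨r, hr, by simp⟩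
  have heq := hR.2.2 (R ∪ {r, u}) Set.subset_union_left
    (Set.union_subset hR.1 (Set.pair_subset (hR.1 hr) huS)) hconn
  exact hu (heq ▸ Or.inr (by simp))

theorem IsCompOf.disjoint {G : SimpleGraph V} {S R T : Set V} (hR : IsCompOf G S R)
    (hT : IsCompOf G S T) (hne : R ≠ T) : Disjoint R T := by
  rw [Set.disjoint_iff_inter_eq_empty, ← Set.not_nonempty_iff_eq_empty]
  intro hRT
  have hconn := SimpleGraph.induce_union_connected hR.2.1.preconnected hT.2.1.preconnected hRT
  have hsub := Set.union_subset hR.1 hT.1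
  exact hne ((hR.2.2 _ Set.subset_union_left hsub hconn).symm.trans
    (hT.2.2 _ Set.subset_union_right hsub hconn))

theorem IsCompOf.not_adj {G : SimpleGraph V} {S R T : Set V} (hR : IsCompOf G S R)
    (hT : IsCompOf G S T) (hne : R ≠ T) {r t : V} (hr : r ∈ R) (ht : t ∈ T) : ¬ G.Adj t r :=
  fun h => hT.1 ht (hR.mem_of_adj hr h ((hR.disjoint hT hne).notMem_of_mem_right ht))

/-- In a `P₄`-free graph, a vertex with neighbors in two components of `G - S` is adjacent to
every vertex of each of them. -/
theorem IsCompOf.adj_of_adjToSet {G : SimpleGraph V} {S R T : Set V} (hG : P4Free G)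
    (hR : IsCompOf G S R) (hT : IsCompOf G S T) (hne : R ≠ T) {u : V}
    (huR : AdjToSet G u R) (huT : AdjToSet G u T) : ∀ r ∈ R, G.Adj u r := by
  obtain ⟨r₀, hr₀, hur₀⟩ := huR
  obtain ⟨t, ht, hut⟩ := huT
  intro r hr
  obtain ⟨p⟩ := hR.2.1.preconnected ⟨r₀, hr₀⟩ ⟨r, hr⟩
  suffices h : ∀ {x y : R}, (G.induce R).Walk x y → G.Adj u x → G.Adj u y from h p hur₀
  intro x y q
  induction q with
  | nil => exact id
  | @cons x y z hxy _ ih =>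
    intro hux
    refine ih ?_
    by_contra huy
    exact hG.false_of_induced_path hut.symm hux hxy (hR.not_adj hT hne x.2 ht) huy
      (hR.not_adj hT hne y.2 ht)

theorem contractSet_adj_inl_inl {G : SimpleGraph V} {R : Set V} {a b : ↥(Rᶜ)} :
    (contractSet G R).Adj (Sum.inl a) (Sum.inl b) ↔ G.Adj a b := by
  simp only [contractSet, SimpleGraph.fromRel_adj, G.adj_comm b a, or_self, ne_eq,
    Sum.inl.injEq, and_iff_right_iff_imp]
  rintro h rfl
  exact h.ne rfl

theorem contractSet_adj_inl_inr {G : SimpleGraph V} {R : Set V} {a : ↥(Rᶜ)} {i : Unit} :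
    (contractSet G R).Adj (Sum.inl a) (Sum.inr i) ↔ AdjToSet G a R := by
  simp [contractSet, AdjToSet]

/-- If every vertex outside `R` with a neighbor in `R` is adjacent to `r ∈ R`, then contracting
`R` gives the subgraph induced by `r` and the vertices outside `R`. -/
def contractSetEmbedding {G : SimpleGraph V} {R : Set V} {r : V} (hr : r ∈ R)
    (h : ∀ a ∉ R, AdjToSet G a R → G.Adj a r) : contractSet G R ↪g G where
  toFun := Sum.elim Subtype.val fun _ => r
  inj' := Subtype.val_injective.sumElim (Function.injective_of_subsingleton _)
    fun a _ ha => a.2 (ha ▸ hr)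
  map_rel_iff' := by
    have hiff : ∀ a : ↥(Rᶜ), G.Adj a r ↔ AdjToSet G a R :=
      fun a => ⟨fun har => ⟨r, hr, har⟩, h a a.2⟩
    rintro (a | i) (b | j)
    · exact contractSet_adj_inl_inl.symm
    · exact (hiff a).trans contractSet_adj_inl_inr.symm
    · exact (G.adj_comm _ _).trans <| (hiff b).trans <|
        contractSet_adj_inl_inr.symm.trans ((contractSet G R).adj_comm _ _)
    · exact iff_of_false G.irrefl (contractSet G R).irrefl

/-- In a connected `P₄`-free graph, for a cutset `S` each of whose
vertices is adjacent to at least two components of `G - S`: contracting a component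
`R` of `G - S` to a single vertex yields a `P₄`-free graph. -/
theorem stmt_9 {V : Type*} [Fintype V] (G : SimpleGraph V) (hconn : G.Connected)
    (hP4 : P4Free G) (S : Set V) (hcut : IsCutset G S)
    (hadj : ∀ u ∈ S, ∃ R₁ R₂ : Set V, IsCompOf G S R₁ ∧ IsCompOf G S R₂ ∧ R₁ ≠ R₂ ∧
      AdjToSet G u R₁ ∧ AdjToSet G u R₂)
    (R : Set V) (hR : IsCompOf G S R) :
    P4Free (contractSet G R) := by
  obtain ⟨r, hr⟩ := hR.2.1.nonempty
  refine hP4.of_embedding (contractSetEmbedding hr fun a haR ha => ?_)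
  obtain ⟨s, hs, has⟩ := ha
  obtain ⟨R₁, R₂, h₁, h₂, hne, ha₁, ha₂⟩ := hadj a (hR.mem_of_adj hs has haR)
  by_cases h : R = R₁
  · exact hR.adj_of_adjToSet hP4 h₂ (h ▸ hne) ⟨s, hs, has⟩ ha₂ r hr
  · exact hR.adj_of_adjToSet hP4 h₁ h ⟨s, hs, has⟩ ha₁ r hr
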